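/- arXiv:2506.20086 — 2 statements merged into one kernel-verified Lean document; each statement's English description precedes it below -/
import Mathlib

section
/- Let D be the graph obtained from the Herschel graph 𝔥 by deleting the edge h₁h₁¹ and adding a new vertex u together with the edges uh₁, uh₁¹, and uh₂ (that is, 𝔥 with the edge h₁h₁¹ subdivided by a new vertex u which is additionally joined to h₂). Then D contains the complete bipartite graph K_{2,6} as a minor. -/
/-- `G` contains `K` as a minor: there are pairwise disjoint nonempty branch sets
`B w ⊆ V(G)`, each inducing a connected subgraph of `G`, such that every edge of `K`
is witnessed by an edge of `G` between the corresponding branch sets. -/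
def HasMinor {V W : Type*} (G : SimpleGraph V) (K : SimpleGraph W) : Prop :=
  ∃ B : W → Set V,
    (∀ w, (B w).Nonempty) ∧
    (∀ w₁ w₂, w₁ ≠ w₂ → Disjoint (B w₁) (B w₂)) ∧
    (∀ w, (G.induce (B w)).Connected) ∧
    (∀ w₁ w₂, K.Adj w₁ w₂ → ∃ u ∈ B w₁, ∃ v ∈ B w₂, G.Adj u v)

/-- Vertex labels in `Fin 12`: `0 = h¹`, `1 = h²`, `2 = h₁`, `3 = h₂`, `4 = h₃`,
`5 = h₁¹`, `6 = h₂¹`, `7 = h₃¹`, `8 = h₁²`, `9 = h₂²`, `10 = h₃²`, `11 = u`.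
These are the edges of the Herschel graph with the edge `h₁h₁¹` deleted,
together with the new edges `uh₁`, `uh₁¹`, and `uh₂`. -/
def subdividedHerschelEdges : List (Fin 12 × Fin 12) :=
  [(0,5),(0,6),(0,7),(1,8),(1,9),(1,10),
   (2,8),(2,7),(2,10),
   (3,6),(3,9),(3,5),(3,8),
   (4,7),(4,10),(4,6),(4,9),
   (11,2),(11,5),(11,3)]

/-- The Herschel graph with the edge `h₁h₁¹` subdivided by a new vertex `u`
that is additionally joined to `h₂`. -/
def SubdividedHerschel : SimpleGraph (Fin 12) :=
  SimpleGraph.fromRel (fun a b => (a, b) ∈ subdividedHerschelEdges)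

/-- A set inducing a star around one of its vertices is connected. -/
theorem SimpleGraph.induce_connected_of_forall_adj {V : Type*} {G : SimpleGraph V} {s : Set V}
    {c : V} (hc : c ∈ s) (h : ∀ v ∈ s, v = c ∨ G.Adj c v) : (G.induce s).Connected := by
  rw [SimpleGraph.connected_iff_exists_forall_reachable]
  refine ⟨⟨c, hc⟩, fun ⟨v, hv⟩ => ?_⟩
  rcases h v hv with rfl | hadj
  · exact SimpleGraph.Reachable.refl _
  · exact SimpleGraph.Adj.reachable (G := G.induce s) hadj

/-- A vertex colouring whose colour classes are stars with centres `c` yields a minor. -/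
theorem HasMinor.of_fibers {V W : Type*} {G : SimpleGraph V} {K : SimpleGraph W}
    (f : V → W) (c : W → V) (hc : ∀ w, f (c w) = w)
    (hstar : ∀ v, v = c (f v) ∨ G.Adj (c (f v)) v)
    (hadj : ∀ w₁ w₂, K.Adj w₁ w₂ → ∃ u v, f u = w₁ ∧ f v = w₂ ∧ G.Adj u v) :
    HasMinor G K := by
  refine ⟨fun w => f ⁻¹' {w}, fun w => ⟨c w, hc w⟩, fun w₁ w₂ hne => ?_, fun w => ?_, ?_⟩
  · exact Disjoint.preimage f (Set.disjoint_singleton.2 hne)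
  · refine SimpleGraph.induce_connected_of_forall_adj (hc w) ?_
    rintro v rfl
    exact hstar v
  · intro w₁ w₂ h
    obtain ⟨u, v, hu, hv, huv⟩ := hadj w₁ w₂ h
    exact ⟨u, hu, v, hv, huv⟩

instance : DecidableRel SubdividedHerschel.Adj := fun a b =>
  inferInstanceAs (Decidable
    (a ≠ b ∧ ((a, b) ∈ subdividedHerschelEdges ∨ (b, a) ∈ subdividedHerschelEdges)))

/-- The partition of the vertices into `{h¹, h₁, h₃¹}`, `{h², h₂, h₂²}` and six singletons. -/
def herschelBranch : Fin 12 → Fin 2 ⊕ Fin 6 :=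
  ![.inl 0, .inl 1, .inl 0, .inl 1, .inr 0, .inr 1, .inr 2, .inl 0, .inr 3, .inl 1, .inr 4, .inr 5]

/-- A centre for each part of `herschelBranch`. -/
def herschelCentre : Fin 2 ⊕ Fin 6 → Fin 12 :=
  Sum.elim ![7, 9] ![4, 5, 6, 8, 10, 11]

theorem exists_adj_between_herschelBranch (i : Fin 2) (j : Fin 6) :
    ∃ u v, herschelBranch u = .inl i ∧ herschelBranch v = .inr j ∧
      SubdividedHerschel.Adj u v := by
  decide +revert

theorem subdividedHerschel_hasMinor_K26 :
    HasMinor SubdividedHerschel (completeBipartiteGraph (Fin 2) (Fin 6)) := by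
  refine HasMinor.of_fibers herschelBranch herschelCentre (by decide) (by decide) ?_
  rintro (i | i) (j | j) h
  · simp at h
  · exact exists_adj_between_herschelBranch i j
  · obtain ⟨u, v, hu, hv, huv⟩ := exists_adj_between_herschelBranch j i
    exact ⟨v, u, hv, hu, huv.symm⟩
  · simp at h
end

section
/- For every integer n ≥ 11, the graph G_n^• is 3-connected. -/
/-- Labels in `Fin 10`: `0 = h¹`, `1 = h²`, `2 = h₁`, `3 = h₂`, `4 = h₃`,
`5 = h₁¹`, `6 = h₂¹`, `7 = h₃¹`, `8 = h₁²`, `9 = h₂²`.  The edges among these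
vertices, including the five dashed edges `h₁h₂, h₂h₃, h₃h₁, h₁h², h₃h²`. -/
def bulletBase : List (Fin 10 × Fin 10) :=
  [(0,5),(0,6),(0,7),(1,8),(1,9),
   (2,5),(2,8),(2,7),
   (3,5),(3,8),(3,6),(3,9),
   (4,6),(4,9),(4,7),
   (2,3),(3,4),(4,2),(2,1),(4,1)]

/-- The graph `G_n^•` for `n ≥ 11`.  The vertex `Sum.inr k` is `v_{k+1}`,
for `0 ≤ k ≤ n - 11`, so that `v₁ = Sum.inr 0` and `v_{n-10} = Sum.inr (n-11)`. -/
def GBullet (n : ℕ) : SimpleGraph (Fin 10 ⊕ Fin (n - 10)) :=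
  SimpleGraph.fromRel (fun a b =>
    match a, b with
    | Sum.inl i, Sum.inl j => (i, j) ∈ bulletBase
    | Sum.inl i, Sum.inr k =>
        (i = 2 ∧ (k : ℕ) = 0) ∨ (i = 4 ∧ (k : ℕ) = n - 11) ∨ i = 1
    | Sum.inr _, Sum.inl _ => False
    | Sum.inr k, Sum.inr l => (l : ℕ) = (k : ℕ) + 1)

/-- A graph is 3-connected if it has more than 3 vertices and removing any set of
at most 2 vertices leaves the induced subgraph on the remaining vertices connected. -/
def ThreeConnected {V : Type*} [Fintype V] (G : SimpleGraph V) : Prop :=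
  3 < Fintype.card V ∧
    ∀ S : Finset V, S.card ≤ 2 → (G.induce ((↑S : Set V)ᶜ)).Connected

/-- The adjacency relation of `GBullet` restricted to its ten fixed vertices. -/
def BaseAdj (i j : Fin 10) : Prop :=
  i ≠ j ∧ ((i, j) ∈ bulletBase ∨ (j, i) ∈ bulletBase)

instance : DecidableRel BaseAdj := fun i j => by unfold BaseAdj; infer_instance

set_option synthInstance.maxSize 1000 in
/-- After deleting at most two of the ten fixed vertices, some remaining vertex is at distance
at most three from every remaining vertex. -/
theorem exists_baseAdj_center : ∀ x y : Option (Fin 10), ∃ r : Fin 10, (some r ≠ x ∧ some r ≠ y) ∧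
    ∀ a : Fin 10, (some a ≠ x ∧ some a ≠ y) →
      ∃ c : Fin 10, (a = c ∨ BaseAdj a c) ∧ (some c ≠ x ∧ some c ≠ y) ∧
        ∃ d : Fin 10, (d = r ∨ BaseAdj d r) ∧ (some d ≠ x ∧ some d ≠ y) ∧
          (c = d ∨ BaseAdj c d) := by
  decide +kernel

theorem GBullet.adj_inl {n : ℕ} {i j : Fin 10} (h : BaseAdj i j) :
    (GBullet n).Adj (Sum.inl i) (Sum.inl j) := by
  simpa [GBullet, BaseAdj] using h

theorem GBullet.adj_inr_one {n : ℕ} (k : Fin (n - 10)) :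
    (GBullet n).Adj (Sum.inr k) (Sum.inl 1) := by
  simp [GBullet]

theorem GBullet.adj_inr_two {n : ℕ} {k : Fin (n - 10)} (hk : (k : ℕ) = 0) :
    (GBullet n).Adj (Sum.inr k) (Sum.inl 2) := by
  simp [GBullet, hk]

theorem GBullet.adj_inr_four {n : ℕ} {k : Fin (n - 10)} (hk : (k : ℕ) = n - 11) :
    (GBullet n).Adj (Sum.inr k) (Sum.inl 4) := by
  simp [GBullet, hk]

theorem GBullet.adj_inr_inr {n : ℕ} {k l : Fin (n - 10)} (h : (l : ℕ) = k + 1) :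
    (GBullet n).Adj (Sum.inr k) (Sum.inr l) := by
  simp [GBullet, h, Fin.ext_iff]

theorem exists_option_mem_inl_iff {α β : Type*} {S : Finset (α ⊕ β)} (hS : S.card ≤ 2) :
    ∃ x y : Option α, ∀ i, Sum.inl i ∉ S ↔ some i ≠ x ∧ some i ≠ y := by
  classical
  have key : ∀ (p : α ⊕ β) (i : α), some i = p.getLeft? ↔ Sum.inl i = p := by
    rintro (p | p) i <;> simp
  obtain h | h | h : S.card = 0 ∨ S.card = 1 ∨ S.card = 2 := by omega
  · exact ⟨none, none, by simp [Finset.card_eq_zero.mp h]⟩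
  · obtain ⟨p, rfl⟩ := Finset.card_eq_one.mp h
    exact ⟨p.getLeft?, p.getLeft?, fun i => by simp only [ne_eq, key]; simp⟩
  · obtain ⟨p, q, -, rfl⟩ := Finset.card_eq_two.mp h
    exact ⟨p.getLeft?, q.getLeft?, fun i => by simp only [ne_eq, key]; simp⟩

theorem GBullet.reachable_two {n : ℕ} {S : Set (Fin 10 ⊕ Fin (n - 10))}
    (h2 : Sum.inl 2 ∈ S) (k : ℕ) (hk : k < n - 10)
    (h : ∀ j : Fin (n - 10), (j : ℕ) ≤ k → Sum.inr j ∈ S) :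
    ((GBullet n).induce S).Reachable ⟨Sum.inr ⟨k, hk⟩, h _ le_rfl⟩ ⟨Sum.inl 2, h2⟩ := by
  induction k with
  | zero => exact SimpleGraph.Adj.reachable (GBullet.adj_inr_two rfl)
  | succ k ih =>
    refine SimpleGraph.Reachable.trans (SimpleGraph.Adj.reachable ?_)
      (ih (by omega) fun j hj => h j (by omega))
    exact (GBullet.adj_inr_inr rfl).symm

theorem GBullet.reachable_four {n : ℕ} {S : Set (Fin 10 ⊕ Fin (n - 10))}
    (h4 : Sum.inl 4 ∈ S) (m k : ℕ) (hk : k < n - 10) (hm : k + m = n - 11)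
    (h : ∀ j : Fin (n - 10), k ≤ (j : ℕ) → Sum.inr j ∈ S) :
    ((GBullet n).induce S).Reachable ⟨Sum.inr ⟨k, hk⟩, h _ le_rfl⟩ ⟨Sum.inl 4, h4⟩ := by
  induction m generalizing k with
  | zero => exact SimpleGraph.Adj.reachable (GBullet.adj_inr_four hm)
  | succ m ih =>
    refine SimpleGraph.Reachable.trans (SimpleGraph.Adj.reachable ?_)
      (ih (k + 1) (by omega) (by omega) fun j hj => h j (by omega))
    exact GBullet.adj_inr_inr rfl

/-- After deleting at most two vertices, every remaining path vertex is still joined to one of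
the ten fixed vertices. -/
theorem GBullet.exists_reachable_inl {n : ℕ} {S : Finset (Fin 10 ⊕ Fin (n - 10))}
    (hS : S.card ≤ 2) (k : Fin (n - 10))
    (hk : Sum.inr k ∈ ((S : Set (Fin 10 ⊕ Fin (n - 10)))ᶜ)) :
    ∃ (i : Fin 10) (hi : Sum.inl i ∈ ((S : Set (Fin 10 ⊕ Fin (n - 10)))ᶜ)),
      ((GBullet n).induce ((S : Set _)ᶜ)).Reachable ⟨Sum.inr k, hk⟩ ⟨Sum.inl i, hi⟩ := by
  by_cases h1 : Sum.inl 1 ∈ S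
  swap
  · exact ⟨1, h1, SimpleGraph.Adj.reachable (GBullet.adj_inr_one k)⟩
  by_contra hcon
  have left : ∃ z ∈ S, z = Sum.inl 2 ∨ ∃ j : Fin (n - 10), j < k ∧ z = Sum.inr j := by
    by_contra! hl
    have h2 : Sum.inl 2 ∉ S := fun h => (hl _ h).1 rfl
    refine hcon ⟨2, h2, GBullet.reachable_two (S := (S : Set _)ᶜ) h2 k k.2 fun j hj hjS => ?_⟩
    obtain rfl | hlt := eq_or_lt_of_le (show j ≤ k from hj)
    · exact hk hjS
    · exact (hl _ hjS).2 j hlt rfl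
  have right : ∃ z ∈ S, z = Sum.inl 4 ∨ ∃ j : Fin (n - 10), k < j ∧ z = Sum.inr j := by
    by_contra! hr
    have h4 : Sum.inl 4 ∉ S := fun h => (hr _ h).1 rfl
    refine hcon ⟨4, h4, GBullet.reachable_four (S := (S : Set _)ᶜ) h4 (n - 11 - k) k k.2
      (by omega) fun j hj hjS => ?_⟩
    obtain rfl | hlt := eq_or_lt_of_le (show k ≤ j from hj)
    · exact hk hjS
    · exact (hr _ hjS).2 j hlt rfl
  obtain ⟨z, hz, hzl⟩ := left
  obtain ⟨w, hw, hwr⟩ := right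
  refine hS.not_gt (Finset.two_lt_card.mpr ⟨_, h1, z, hz, w, hw, ?_, ?_, ?_⟩)
  · rcases hzl with rfl | ⟨j, -, rfl⟩ <;> simp
  · rcases hwr with rfl | ⟨j, -, rfl⟩ <;> simp
  · rcases hzl with rfl | ⟨j, hj, rfl⟩ <;> rcases hwr with rfl | ⟨l, hl, rfl⟩ <;> simp
    exact (hj.trans hl).ne

theorem gBullet_threeConnected (n : ℕ) (hn : 11 ≤ n) :
    ThreeConnected (GBullet n) := by
  refine ⟨by simp; omega, fun S hS => ?_⟩
  obtain ⟨x, y, hxy⟩ := exists_option_mem_inl_iff hS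
  obtain ⟨r, hr, hcenter⟩ := exists_baseAdj_center x y
  have step {i j : Fin 10} (hi : Sum.inl i ∉ S) (hj : Sum.inl j ∉ S) (h : i = j ∨ BaseAdj i j) :
      ((GBullet n).induce ((S : Set _)ᶜ)).Reachable ⟨Sum.inl i, hi⟩ ⟨Sum.inl j, hj⟩ := by
    obtain rfl | h := h
    · rfl
    · exact SimpleGraph.Adj.reachable (GBullet.adj_inl h)
  have base (i : Fin 10) (hi : Sum.inl i ∉ S) :
      ((GBullet n).induce ((S : Set _)ᶜ)).Reachable ⟨Sum.inl i, hi⟩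
        ⟨Sum.inl r, (hxy r).mpr hr⟩ := by
    obtain ⟨c, hic, hc, d, hdr, hd, hcd⟩ := hcenter i ((hxy i).mp hi)
    rw [← hxy] at hc hd
    exact ((step hi hc hic).trans (step hc hd hcd)).trans (step hd _ hdr)
  refine SimpleGraph.connected_iff_exists_forall_reachable _ |>.mpr
    ⟨⟨Sum.inl r, (hxy r).mpr hr⟩, ?_⟩
  rintro ⟨i | k, hv⟩
  · exact (base i hv).symm
  · obtain ⟨i, hi, hki⟩ := GBullet.exists_reachable_inl hS k hv
    exact (hki.trans (base i hi)).symm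
end
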